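/- arXiv:2412.17841 — 5 statements merged into one kernel-verified Lean document; each statement's English description precedes it below -/
import Mathlib

section
/- Case 1 of the correctness proposition: for every binary vector x ∈ {0,1}^n with x_i = 0 and x_j = 0, setting the ancilla bit to 0 preserves the energy exactly: H_mod(x, 0) = H(x). (No condition on z is needed.) -/
/-- The QUBO energy `H(x) = ∑_{p ≤ q} x_p x_q Q_{p,q}`. -/
def energy {m : ℕ} (A : Matrix (Fin m) (Fin m) ℝ) (x : Fin m → ℝ) : ℝ :=
  ∑ p : Fin m, ∑ q ∈ Finset.Ici p, x p * x q * A p q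

/-- `x` is a binary ({0,1}-valued) vector. -/
def IsBinary {m : ℕ} (x : Fin m → ℝ) : Prop := ∀ p, x p = 0 ∨ x p = 1

/-- The row/column of the ancilla qubit in the enhanced matrix. -/
def ancRow {n : ℕ} (Q : Matrix (Fin n) (Fin n) ℝ) (i j : Fin n) (U : Finset (Fin n)) (z : ℝ)
    (k : Fin n) : ℝ :=
  if k = i ∨ k = j then -2 * z else if k ∈ U then Q i k else 0

/-- The enhanced matrix restricted to the original `n × n` block. -/
def coreMod {n : ℕ} (Q : Matrix (Fin n) (Fin n) ℝ) (i j : Fin n) (U : Finset (Fin n)) (z : ℝ) :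
    Matrix (Fin n) (Fin n) ℝ := fun p q =>
  if p = i ∧ q = i then Q i i + z
  else if p = j ∧ q = j then Q j j + z
  else if (p = i ∧ q = j) ∨ (p = j ∧ q = i) then 2 * z
  else if ((p = i ∨ p = j) ∧ q ∈ U) ∨ (p ∈ U ∧ (q = i ∨ q = j)) then 0
  else Q p q

/-- The enhanced `(n+1) × (n+1)` matrix `Q_mod`, the ancilla being the last index. -/
def QMod {n : ℕ} (Q : Matrix (Fin n) (Fin n) ℝ) (i j : Fin n) (U : Finset (Fin n)) (z : ℝ) :
    Matrix (Fin (n + 1)) (Fin (n + 1)) ℝ := fun p q =>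
  Fin.lastCases
    (Fin.lastCases z (fun k => ancRow Q i j U z k) q)
    (fun p' => Fin.lastCases (ancRow Q i j U z p') (fun q' => coreMod Q i j U z p' q') q)
    p

/-- The modified energy `H_mod(x, b)`: the energy of `x` extended by the ancilla value `b`. -/
noncomputable def energyMod {n : ℕ} (Q : Matrix (Fin n) (Fin n) ℝ) (i j : Fin n)
    (U : Finset (Fin n)) (z : ℝ) (x : Fin n → ℝ) (b : ℝ) : ℝ :=
  energy (QMod Q i j U z) (Fin.snoc x b)

/-- `z = ∑_{p ≤ q} |Q_{p,q}|`, the value of `z` used in the correctness proposition. -/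
def totalWeight {n : ℕ} (Q : Matrix (Fin n) (Fin n) ℝ) : ℝ :=
  ∑ p : Fin n, ∑ q ∈ Finset.Ici p, |Q p q|

theorem energy_eq_sum_ite {m : ℕ} (A : Matrix (Fin m) (Fin m) ℝ) (x : Fin m → ℝ) :
    energy A x = ∑ p : Fin m, ∑ q : Fin m, if p ≤ q then x p * x q * A p q else 0 := by
  refine Finset.sum_congr rfl fun p _ => ?_
  rw [← Finset.sum_filter]
  exact Finset.sum_congr (by ext q; simp) fun _ _ => rfl

/-- Appending a bit with value `0` leaves only the energy of the leading principal block. -/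
theorem energy_snoc_zero {n : ℕ} (A : Matrix (Fin (n + 1)) (Fin (n + 1)) ℝ) (x : Fin n → ℝ) :
    energy A (Fin.snoc x 0) = energy (A.submatrix Fin.castSucc Fin.castSucc) x := by
  simp [energy_eq_sum_ite, Fin.sum_univ_castSucc]

theorem QMod_submatrix_castSucc {n : ℕ} (Q : Matrix (Fin n) (Fin n) ℝ) (i j : Fin n)
    (U : Finset (Fin n)) (z : ℝ) :
    (QMod Q i j U z).submatrix Fin.castSucc Fin.castSucc = coreMod Q i j U z := by
  ext p q
  simp [QMod]

theorem coreMod_apply_of_ne {n : ℕ} (Q : Matrix (Fin n) (Fin n) ℝ) {i j p q : Fin n}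
    (U : Finset (Fin n)) (z : ℝ) (hpi : p ≠ i) (hpj : p ≠ j) (hqi : q ≠ i) (hqj : q ≠ j) :
    coreMod Q i j U z p q = Q p q := by
  simp [coreMod, hpi, hpj, hqi, hqj]

theorem case1_xi0_xj0_anc0 {n : ℕ} (Q : Matrix (Fin n) (Fin n) ℝ) (hQ : Q.IsSymm)
    (i j : Fin n) (hij : i ≠ j) (U : Finset (Fin n)) (hiU : i ∉ U) (hjU : j ∉ U)
    (hU : ∀ k ∈ U, Q i k = Q j k) (z : ℝ)
    (x : Fin n → ℝ) (hx : IsBinary x) (hxi : x i = 0) (hxj : x j = 0) :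
    energyMod Q i j U z x 0 = energy Q x := by
  rw [energyMod, energy_snoc_zero, QMod_submatrix_castSucc]
  refine Finset.sum_congr rfl fun p _ => Finset.sum_congr rfl fun q _ => ?_
  have ne_of_apply_ne_zero {k : Fin n} (hk : x k ≠ 0) : k ≠ i ∧ k ≠ j :=
    ⟨fun h => hk (h ▸ hxi), fun h => hk (h ▸ hxj)⟩
  by_cases hp : x p = 0
  · simp [hp]
  by_cases hq : x q = 0
  · simp [hq]
  obtain ⟨hpi, hpj⟩ := ne_of_apply_ne_zero hp
  obtain ⟨hqi, hqj⟩ := ne_of_apply_ne_zero hq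
  rw [coreMod_apply_of_ne Q U z hpi hpj hqi hqj]
end

section
/- Case 2 of the correctness proposition: for every binary vector x ∈ {0,1}^n with x_i = 0 and x_j = 0, setting the ancilla bit to 1 gives H_mod(x, 1) = H(x) + z + ∑_{k ∈ U, x_k = 1} Q_{i,k}. In particular, if z = ∑_{1 ≤ p ≤ q ≤ n} |Q_{p,q}|, then H_mod(x, 1) ≥ H(x). -/
theorem energy_snoc_one {n : ℕ} (A : Matrix (Fin (n + 1)) (Fin (n + 1)) ℝ) (x : Fin n → ℝ) :
    energy A (Fin.snoc x 1)
      = energy (fun p q => A p.castSucc q.castSucc) x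
        + ∑ p, x p * A p.castSucc (Fin.last n) + A (Fin.last n) (Fin.last n) := by
  have sum_Ici : ∀ {m : ℕ} (p : Fin m) (f : Fin m → ℝ),
      ∑ q ∈ Finset.Ici p, f q = ∑ q, if p ≤ q then f q else 0 := by
    intro m p f
    rw [← Finset.sum_filter]
    congr 1
    ext q
    simp
  simp only [energy, sum_Ici, Fin.sum_univ_castSucc, Fin.snoc_castSucc, Fin.snoc_last,
    Fin.castSucc_le_castSucc_iff, Fin.le_last, if_true, Finset.sum_add_distrib]
  simp [Fin.last_le_iff, Fin.castSucc_ne_last, add_assoc]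

theorem sum_abs_row_le_totalWeight {n : ℕ} (Q : Matrix (Fin n) (Fin n) ℝ) (hQ : Q.IsSymm)
    (i : Fin n) : ∑ k, |Q i k| ≤ totalWeight Q := by
  have hrow : ∀ p : Fin n,
      (if p = i then ∑ q ∈ Finset.Ici i, |Q i q| else 0) + (if p < i then |Q i p| else 0)
        ≤ ∑ q ∈ Finset.Ici p, |Q p q| := by
    intro p
    have hnn : 0 ≤ ∑ q ∈ Finset.Ici p, |Q p q| := Finset.sum_nonneg fun _ _ => abs_nonneg _
    rcases lt_trichotomy p i with h | rfl | h
    · rw [if_neg h.ne, if_pos h, zero_add, ← hQ.apply i p]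
      exact Finset.single_le_sum (f := fun q => |Q p q|) (fun _ _ => abs_nonneg _)
        (Finset.mem_Ici.2 h.le)
    · simp
    · simpa [h.ne', h.not_gt] using hnn
  have hsplit : ∑ k, |Q i k|
      = ∑ q ∈ Finset.Ici i, |Q i q| + ∑ p, if p < i then |Q i p| else 0 := by
    rw [← Finset.sum_filter, ← Finset.sum_filter_add_sum_filter_not Finset.univ (fun k => i ≤ k)]
    congr 1 <;> congr 1 <;> ext <;> simp
  calc ∑ k, |Q i k|
      = ∑ p, ((if p = i then ∑ q ∈ Finset.Ici i, |Q i q| else 0)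
          + (if p < i then |Q i p| else 0)) := by
        rw [hsplit, Finset.sum_add_distrib]
        simp
    _ ≤ totalWeight Q := Finset.sum_le_sum fun p _ => hrow p

theorem energy_coreMod_of_eq_zero {n : ℕ} (Q : Matrix (Fin n) (Fin n) ℝ) (i j : Fin n)
    (U : Finset (Fin n)) (z : ℝ) (x : Fin n → ℝ) (hxi : x i = 0) (hxj : x j = 0) :
    energy (coreMod Q i j U z) x = energy Q x := by
  refine Finset.sum_congr rfl fun p _ => Finset.sum_congr rfl fun q _ => ?_
  by_cases hpi : p = i
  · simp [hpi, hxi]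
  by_cases hpj : p = j
  · simp [hpj, hxj]
  by_cases hqi : q = i
  · simp [hqi, hxi]
  by_cases hqj : q = j
  · simp [hqj, hxj]
  simp [coreMod, hpi, hpj, hqi, hqj]

theorem sum_mul_ancRow_of_eq_zero {n : ℕ} (Q : Matrix (Fin n) (Fin n) ℝ) (i j : Fin n)
    (U : Finset (Fin n)) (z : ℝ) (x : Fin n → ℝ) (hx : IsBinary x)
    (hxi : x i = 0) (hxj : x j = 0) :
    ∑ p, x p * ancRow Q i j U z p = ∑ k ∈ U.filter (fun k => x k = 1), Q i k := by
  have hU : U.filter (fun k => x k = 1) = Finset.univ.filter (fun k => k ∈ U ∧ x k = 1) := by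
    ext
    simp
  rw [hU, Finset.sum_filter]
  refine Finset.sum_congr rfl fun p _ => ?_
  by_cases hpi : p = i
  · simp [hpi, hxi]
  by_cases hpj : p = j
  · simp [hpj, hxj]
  rcases hx p with h | h <;> simp [ancRow, hpi, hpj, h]

theorem case2_xi0_xj0_anc1 {n : ℕ} (Q : Matrix (Fin n) (Fin n) ℝ) (hQ : Q.IsSymm)
    (i j : Fin n) (hij : i ≠ j) (U : Finset (Fin n)) (hiU : i ∉ U) (hjU : j ∉ U)
    (hU : ∀ k ∈ U, Q i k = Q j k) (z : ℝ)
    (x : Fin n → ℝ) (hx : IsBinary x) (hxi : x i = 0) (hxj : x j = 0) :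
    (energyMod Q i j U z x 1
      = energy Q x + z + ∑ k ∈ U.filter (fun k => x k = 1), Q i k) ∧
    (z = totalWeight Q → energyMod Q i j U z x 1 ≥ energy Q x) := by
  have heq : energyMod Q i j U z x 1
      = energy Q x + z + ∑ k ∈ U.filter (fun k => x k = 1), Q i k := by
    rw [energyMod, energy_snoc_one, ← sum_mul_ancRow_of_eq_zero Q i j U z x hx hxi hxj,
      ← energy_coreMod_of_eq_zero Q i j U z x hxi hxj]
    simp only [QMod, Fin.lastCases_castSucc, Fin.lastCases_last]
    ring
  refine ⟨heq, fun hz => ?_⟩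
  have hle : -∑ k ∈ U.filter (fun k => x k = 1), Q i k ≤ z := by
    calc -∑ k ∈ U.filter (fun k => x k = 1), Q i k
        ≤ |∑ k ∈ U.filter (fun k => x k = 1), Q i k| := neg_le_abs _
      _ ≤ ∑ k ∈ U.filter (fun k => x k = 1), |Q i k| := Finset.abs_sum_le_sum_abs _ _
      _ ≤ ∑ k, |Q i k| :=
        Finset.sum_le_univ_sum_of_nonneg fun _ => abs_nonneg _
      _ ≤ z := hz ▸ sum_abs_row_le_totalWeight Q hQ i
  linarith
end

section
/- Case 5 of the correctness proposition: for every binary vector x ∈ {0,1}^n with x_i = 0 and x_j = 1, setting the ancilla bit to 0 gives H_mod(x, 0) = H(x) + z - ∑_{k ∈ U, x_k = 1} Q_{j,k}. In particular, if z = ∑_{1 ≤ p ≤ q ≤ n} |Q_{p,q}|, then H_mod(x, 0) ≥ H(x). -/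
/-- A symmetric pattern supported on row and column `j`, summed over the upper triangle. -/
lemma sum_upper_row_add_col {n : ℕ} (j : Fin n) (F : Finset (Fin n)) (hj : j ∉ F)
    (f : Fin n → ℝ) :
    ∑ p : Fin n, ∑ q ∈ Finset.Ici p,
      ((if p = j ∧ q ∈ F then f q else 0) + (if q = j ∧ p ∈ F then f p else 0))
      = ∑ k ∈ F, f k := by
  simp only [Finset.sum_add_distrib]
  have row : ∑ p : Fin n, ∑ q ∈ Finset.Ici p, (if p = j ∧ q ∈ F then f q else 0)
      = ∑ k : Fin n, if j ≤ k ∧ k ∈ F then f k else 0 := by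
    rw [Finset.sum_eq_single j (fun p _ hp => by simp [hp]) (by simp)]
    rw [← Finset.sum_subset (Finset.subset_univ (Finset.Ici j))]
    · refine Finset.sum_congr rfl fun q hq => ?_
      simp [Finset.mem_Ici.mp hq]
    · intro q _ hq
      simp_all
  have col : ∑ p : Fin n, ∑ q ∈ Finset.Ici p, (if q = j ∧ p ∈ F then f p else 0)
      = ∑ k : Fin n, if k ≤ j ∧ k ∈ F then f k else 0 := by
    refine Finset.sum_congr rfl fun p _ => ?_
    simp only [ite_and, Finset.sum_ite_eq', Finset.mem_Ici]
  rw [row, col, ← Finset.sum_add_distrib, ← Finset.sum_filter_add_sum_filter_not Finset.univ (· ∈ F)]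
  rw [Finset.sum_eq_zero (s := Finset.univ.filter (· ∉ F)) (fun k hk => by simp_all), add_zero]
  refine Finset.sum_congr (by simp) fun k hk => ?_
  have hk' : k ∈ F := by simpa using hk
  rcases lt_or_gt_of_ne (fun h : k = j => hj (h ▸ hk')) with h | h
  · simp [hk', h.le, h.not_ge]
  · simp [hk', h.le, h.not_ge]

/-- The energy over the extended index set, with the ancilla switched off, is the energy of the
original block. -/
lemma energyMod_zero {n : ℕ} (Q : Matrix (Fin n) (Fin n) ℝ) (i j : Fin n)
    (U : Finset (Fin n)) (z : ℝ) (x : Fin n → ℝ) :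
    energyMod Q i j U z x 0 = energy (coreMod Q i j U z) x := by
  have upper : ∀ {m : ℕ} (A : Matrix (Fin m) (Fin m) ℝ) (y : Fin m → ℝ),
      energy A y = ∑ p : Fin m, ∑ q : Fin m, if p ≤ q then y p * y q * A p q else 0 := by
    intro m A y
    refine Finset.sum_congr rfl fun p _ => ?_
    rw [← Finset.sum_filter]
    exact Finset.sum_congr (by ext; simp) fun _ _ => rfl
  rw [energyMod, upper, upper]
  simp [Fin.sum_univ_castSucc, QMod]

/-- The entries of `coreMod`, weighted by a vector with `x i = 0` and `x j = 1`. -/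
lemma mul_coreMod {n : ℕ} (Q : Matrix (Fin n) (Fin n) ℝ) (hQ : Q.IsSymm)
    (i j : Fin n) (U : Finset (Fin n)) (hjU : j ∉ U) (z : ℝ)
    (x : Fin n → ℝ) (hx : IsBinary x) (hxi : x i = 0) (hxj : x j = 1) (p q : Fin n) :
    x p * x q * coreMod Q i j U z p q
      = x p * x q * Q p q + (if p = j ∧ q = j then z else 0)
        - ((if p = j ∧ q ∈ U.filter (fun k => x k = 1) then Q j q else 0)
          + (if q = j ∧ p ∈ U.filter (fun k => x k = 1) then Q j p else 0)) := by
  have hs : Q p q = Q q p := hQ.apply q p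
  have hji : j ≠ i := fun h => by simp [h, hxi] at hxj
  have hp := hx p
  have hq := hx q
  simp only [coreMod, Finset.mem_filter]
  by_cases hpi : p = i
  · subst hpi; simp [hxi, hji.symm]
  by_cases hqi : q = i
  · subst hqi; simp [hxi, hji.symm]
  by_cases hpj : p = j <;> by_cases hqj : q = j
  · subst hpj; subst hqj; simp [hxj, hji, hjU]
  · subst hpj
    rcases hq with h | h <;> by_cases hqU : q ∈ U <;> simp [*]
  · subst hqj
    rcases hp with h | h <;> by_cases hpU : p ∈ U <;> simp [*]
  · simp [*]

/-- The entries of row `j` indexed by a set avoiding `j` sum to at most `totalWeight Q`. -/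
lemma sum_row_le_totalWeight {n : ℕ} (Q : Matrix (Fin n) (Fin n) ℝ) (hQ : Q.IsSymm)
    (j : Fin n) (F : Finset (Fin n)) (hj : j ∉ F) :
    ∑ k ∈ F, Q j k ≤ totalWeight Q := by
  rw [← sum_upper_row_add_col j F hj (fun k => Q j k), totalWeight]
  refine Finset.sum_le_sum fun p _ => Finset.sum_le_sum fun q _ => ?_
  by_cases h₁ : p = j ∧ q ∈ F
  · obtain ⟨rfl, hq⟩ := h₁
    simp [hj, hq, le_abs_self]
  by_cases h₂ : q = j ∧ p ∈ F
  · obtain ⟨rfl, hp⟩ := h₂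
    simp [hj, hp, hQ.apply p q, le_abs_self]
  · simp [h₁, h₂]

theorem case5_xi0_xj1_anc0 {n : ℕ} (Q : Matrix (Fin n) (Fin n) ℝ) (hQ : Q.IsSymm)
    (i j : Fin n) (hij : i ≠ j) (U : Finset (Fin n)) (hiU : i ∉ U) (hjU : j ∉ U)
    (hU : ∀ k ∈ U, Q i k = Q j k) (z : ℝ)
    (x : Fin n → ℝ) (hx : IsBinary x) (hxi : x i = 0) (hxj : x j = 1) :
    (energyMod Q i j U z x 0
      = energy Q x + z - ∑ k ∈ U.filter (fun k => x k = 1), Q j k) ∧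
    (z = totalWeight Q → energyMod Q i j U z x 0 ≥ energy Q x) := by
  have hjF : j ∉ U.filter (fun k => x k = 1) := fun h => hjU (Finset.mem_filter.mp h).1
  have main : energyMod Q i j U z x 0
      = energy Q x + z - ∑ k ∈ U.filter (fun k => x k = 1), Q j k := by
    rw [energyMod_zero, energy, energy]
    simp only [mul_coreMod Q hQ i j U hjU z x hx hxi hxj, Finset.sum_sub_distrib]
    rw [sum_upper_row_add_col j _ hjF (fun k => Q j k)]
    simp [Finset.sum_add_distrib, ite_and]
  refine ⟨main, fun hz => ?_⟩
  have := sum_row_le_totalWeight Q hQ j _ hjF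
  rw [main]
  linarith
end

section
/- Proposition (invalid solutions): assume z = ∑_{1 ≤ p ≤ q ≤ n} |Q_{p,q}|. For every binary vector x ∈ {0,1}^n that is invalid, i.e. x_i = 1 and x_j = 1, the modified energy does not decrease for either ancilla value: H_mod(x, b) ≥ H(x) for both b = 0 and b = 1. -/
/-- For symmetric `F`, the sum over `p ≤ q` is half of the full sum plus the diagonal. -/
theorem two_mul_sum_Ici_of_symm {m : ℕ} (F : Fin m → Fin m → ℝ) (hF : ∀ p q, F p q = F q p) :
    2 * ∑ p, ∑ q ∈ Finset.Ici p, F p q = ∑ p, ∑ q, F p q + ∑ p, F p p := by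
  have h₁ : ∀ p, ∑ q ∈ Finset.Ici p, F p q = ∑ q, if p ≤ q then F p q else 0 := by
    intro p
    rw [← Finset.sum_filter]
    congr 1
    ext q
    simp
  have h₂ : ∑ p, ∑ q, (if p ≤ q then F p q else 0) = ∑ p, ∑ q, if q ≤ p then F p q else 0 := by
    rw [Finset.sum_comm]
    simp only [hF]
  have h₃ : ∑ p, F p p = ∑ p, ∑ q, if p = q then F p q else 0 := by simp
  simp only [h₁]
  rw [two_mul]
  nth_rewrite 2 [h₂]
  rw [h₃]
  simp only [← Finset.sum_add_distrib]
  refine Finset.sum_congr rfl fun p _ => Finset.sum_congr rfl fun q _ => ?_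
  rcases lt_trichotomy p q with h | h | h
  · simp [h.le, h.not_ge, h.ne]
  · simp [h]
  · simp [h.le, h.not_ge, h.ne']

theorem two_mul_energy_of_symm {m : ℕ} (A : Matrix (Fin m) (Fin m) ℝ)
    (hA : ∀ p q, A p q = A q p) (x : Fin m → ℝ) :
    2 * energy A x = ∑ p, ∑ q, x p * x q * A p q + ∑ p, x p * x p * A p p :=
  two_mul_sum_Ici_of_symm (fun p q => x p * x q * A p q) fun p q => by
    rw [hA p q, mul_comm (x p)]

section QMod

variable {n : ℕ} (Q : Matrix (Fin n) (Fin n) ℝ) (i j : Fin n) (U : Finset (Fin n)) (z : ℝ)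

theorem coreMod_symm (hQ : ∀ p q, Q p q = Q q p) (p q : Fin n) :
    coreMod Q i j U z p q = coreMod Q i j U z q p := by
  have := hQ p q
  unfold coreMod
  grind

theorem QMod_symm (hQ : ∀ p q, Q p q = Q q p) (p q : Fin (n + 1)) :
    QMod Q i j U z p q = QMod Q i j U z q p := by
  cases p using Fin.lastCases with
  | last => cases q using Fin.lastCases <;> simp [QMod]
  | cast p =>
    cases q using Fin.lastCases with
    | last => simp [QMod]
    | cast q => simpa [QMod] using coreMod_symm Q i j U z hQ p q

/-- The modified energy splits into the original block and the contribution of the ancilla. -/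
theorem energyMod_eq (hQ : ∀ p q, Q p q = Q q p) (x : Fin n → ℝ) (b : ℝ) :
    energyMod Q i j U z x b = energy (coreMod Q i j U z) x
      + b * ∑ k, x k * ancRow Q i j U z k + b * b * z := by
  have h₁ := two_mul_energy_of_symm _ (QMod_symm Q i j U z hQ) (Fin.snoc x b : Fin (n + 1) → ℝ)
  have h₂ := two_mul_energy_of_symm _ (coreMod_symm Q i j U z hQ) x
  simp only [Fin.sum_univ_castSucc, Fin.snoc_castSucc, Fin.snoc_last, QMod, Fin.lastCases_last,
    Fin.lastCases_castSucc, Finset.sum_add_distrib] at h₁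
  have h₃ : ∑ k, x k * b * ancRow Q i j U z k = b * ∑ k, x k * ancRow Q i j U z k := by
    rw [Finset.mul_sum]
    exact Finset.sum_congr rfl fun k _ => by ring
  have h₄ : ∑ k, b * x k * ancRow Q i j U z k = b * ∑ k, x k * ancRow Q i j U z k := by
    rw [Finset.mul_sum]
    exact Finset.sum_congr rfl fun k _ => by ring
  rw [h₃, h₄] at h₁
  unfold energyMod
  linarith

variable {i j U}

theorem sum_mul_ancRow (hij : i ≠ j) (hiU : i ∉ U) (hjU : j ∉ U) (x : Fin n → ℝ) :
    ∑ k, x k * ancRow Q i j U z k = -2 * z * (x i + x j) + ∑ k ∈ U, x k * Q i k := by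
  have h : ∀ k, x k * ancRow Q i j U z k = (if k = i then -2 * z * x k else 0)
      + (if k = j then -2 * z * x k else 0) + (if k ∈ U then x k * Q i k else 0) := by
    intro k
    unfold ancRow
    grind
  simp only [h, Finset.sum_add_distrib, Finset.sum_ite_eq', Finset.sum_ite_mem, Finset.univ_inter,
    Finset.mem_univ, if_true]
  ring

theorem coreMod_eq (hQ : ∀ p q, Q p q = Q q p) (hij : i ≠ j) (hiU : i ∉ U) (hjU : j ∉ U)
    (hU : ∀ k ∈ U, Q i k = Q j k) (p q : Fin n) :
    coreMod Q i j U z p q = Q p q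
      + (if p = i then if q = i then z else 0 else 0)
      + (if p = j then if q = j then z else 0 else 0)
      + (if p = i then if q = j then 2 * z - Q i j else 0 else 0)
      + (if p = j then if q = i then 2 * z - Q i j else 0 else 0)
      - (if p = i then if q ∈ U then Q i q else 0 else 0)
      - (if p = j then if q ∈ U then Q i q else 0 else 0)
      - (if q = i then if p ∈ U then Q i p else 0 else 0)
      - (if q = j then if p ∈ U then Q i p else 0 else 0) := by
  have h₁ := hQ p q
  have h₂ := hQ i j
  have h₃ := hU p
  have h₄ := hU q
  unfold coreMod
  grind

theorem energy_coreMod (hQ : ∀ p q, Q p q = Q q p) (hij : i ≠ j) (hiU : i ∉ U) (hjU : j ∉ U)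
    (hU : ∀ k ∈ U, Q i k = Q j k) (x : Fin n → ℝ) :
    energy (coreMod Q i j U z) x = energy Q x + z * (x i * x i + x j * x j)
      + x i * x j * (2 * z - Q i j) - (x i + x j) * ∑ k ∈ U, x k * Q i k := by
  have h₁ := two_mul_energy_of_symm _ (coreMod_symm Q i j U z hQ) x
  have h₂ := two_mul_energy_of_symm Q hQ x
  have hd : ∀ p, coreMod Q i j U z p p = Q p p + (if p = i then z else 0)
      + (if p = j then z else 0) := by
    intro p
    unfold coreMod
    grind
  have hsum : ∀ c : ℝ, ∑ k ∈ U, c * x k * Q i k = c * ∑ k ∈ U, x k * Q i k := by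
    intro c
    rw [Finset.mul_sum]
    exact Finset.sum_congr rfl fun k _ => by ring
  have hsum' : ∀ c : ℝ, ∑ k ∈ U, x k * c * Q i k = c * ∑ k ∈ U, x k * Q i k := by
    intro c
    rw [← hsum]
    exact Finset.sum_congr rfl fun k _ => by ring
  have hout : ∀ (a : Fin n) (f : Fin n → Fin n → ℝ),
      ∑ p, ∑ q, (if p = a then f p q else 0) = ∑ q, f a q := by
    intro a f
    rw [Finset.sum_comm]
    simp
  simp only [hd] at h₁
  simp only [coreMod_eq Q z hQ hij hiU hjU hU, mul_add, mul_sub, mul_ite, mul_zero,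
    Finset.sum_add_distrib, Finset.sum_sub_distrib, hout, Finset.sum_ite_eq', Finset.sum_ite_mem,
    Finset.univ_inter, Finset.mem_univ, if_true, hsum, hsum'] at h₁
  linarith

theorem abs_add_sum_abs_le_totalWeight (hQ : ∀ p q, Q p q = Q q p) (hij : i ≠ j) (hiU : i ∉ U)
    (hjU : j ∉ U) : |Q i j| + ∑ k ∈ U, |Q i k| ≤ totalWeight Q := by
  have h₁ : 2 * totalWeight Q = _ :=
    two_mul_sum_Ici_of_symm (fun p q => |Q p q|) fun p q => by rw [hQ p q]
  have h₂ : 0 ≤ ∑ p, |Q p p| := Finset.sum_nonneg fun p _ => abs_nonneg _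
  have h₃ : ∑ p, ∑ q, ((if p = i then if q = j then |Q i j| else 0 else 0)
      + (if p = i then if q ∈ U then |Q i q| else 0 else 0)
      + (if q = i then if p = j then |Q i j| else 0 else 0)
      + (if q = i then if p ∈ U then |Q i p| else 0 else 0)) ≤ ∑ p, ∑ q, |Q p q| := by
    refine Finset.sum_le_sum fun p _ => Finset.sum_le_sum fun q _ => ?_
    have h := hQ p q
    have h' := abs_nonneg (Q p q)
    grind
  have hout : ∀ (a : Fin n) (f : Fin n → Fin n → ℝ),
      ∑ p, ∑ q, (if p = a then f p q else 0) = ∑ q, f a q := by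
    intro a f
    rw [Finset.sum_comm]
    simp
  simp only [Finset.sum_add_distrib, hout, Finset.sum_ite_eq', Finset.sum_ite_mem,
    Finset.univ_inter, Finset.mem_univ, if_true] at h₃
  linarith

end QMod

theorem invalid_solutions_energy_not_decreased {n : ℕ} (Q : Matrix (Fin n) (Fin n) ℝ) (hQ : Q.IsSymm)
    (i j : Fin n) (hij : i ≠ j) (U : Finset (Fin n)) (hiU : i ∉ U) (hjU : j ∉ U)
    (hU : ∀ k ∈ U, Q i k = Q j k) (z : ℝ)
    (x : Fin n → ℝ) (hx : IsBinary x)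
    (hz : z = totalWeight Q) (hxi : x i = 1) (hxj : x j = 1) :
    ∀ b : ℝ, b = 0 ∨ b = 1 → energyMod Q i j U z x b ≥ energy Q x := by
  have hS : ∀ p q, Q p q = Q q p := fun p q => hQ.apply q p
  have hw := abs_add_sum_abs_le_totalWeight Q hS hij hiU hjU
  have hsum : ∑ k ∈ U, x k * Q i k ≤ ∑ k ∈ U, |Q i k| := by
    refine Finset.sum_le_sum fun k _ => ?_
    rcases hx k with h | h
    · simp [h]
    · simpa [h] using le_abs_self (Q i k)
  have hnonneg : 0 ≤ ∑ k ∈ U, |Q i k| := Finset.sum_nonneg fun k _ => abs_nonneg _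
  have hle := le_abs_self (Q i j)
  have habs := abs_nonneg (Q i j)
  intro b hb
  rw [energyMod_eq Q i j U z hS, energy_coreMod Q z hS hij hiU hjU hU,
    sum_mul_ancRow Q z hij hiU hjU, hxi, hxj]
  rcases hb with rfl | rfl <;> linarith
end

section
/- Correctness of the conflict-detection criterion (GetConflictList): let Z_i = ∑_{k : Q_{i,k} < 0} Q_{i,k} denote the sum of the negative entries of row i of Q (over all k ∈ {1,…,n}). If Q_{i,j} > -Z_i - Z_j for distinct indices i, j, then (i,j) are conflicting qubits: for every binary vector x ∈ {0,1}^n with x_i = 1 and x_j = 1, the energy H(x) is strictly larger than the energy of each of the three vectors obtained from x by setting x_i to 0, by setting x_j to 0, and by setting both x_i and x_j to 0. -/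
/-- `Z_i`: the sum of the negative entries of row `i` of `Q`. -/
noncomputable def negRowSum {n : ℕ} (Q : Matrix (Fin n) (Fin n) ℝ) (i : Fin n) : ℝ :=
  ∑ k : Fin n, if Q i k < 0 then Q i k else 0

/-- Clearing an active variable lowers the energy by the weighted sum of its row. -/
theorem energy_eq_energy_update_add {n : ℕ} {Q : Matrix (Fin n) (Fin n) ℝ} (hQ : Q.IsSymm)
    {i : Fin n} {x : Fin n → ℝ} (hi : x i = 1) :
    energy Q x = energy Q (Function.update x i 0) + ∑ k, x k * Q i k := by
  have henergy (y : Fin n → ℝ) :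
      energy Q y = ∑ p, ∑ q, if p ≤ q then y p * y q * Q p q else 0 := by
    refine Finset.sum_congr rfl fun p _ => ?_
    rw [← Finset.sum_filter]
    congr 1
    ext q
    simp
  have hrow : ∑ k, x k * Q i k =
      ∑ p, ∑ q, ((if p = i then (if i ≤ q then x q * Q i q else 0) else 0) +
        (if q = i then (if p < i then x p * Q i p else 0) else 0)) := by
    simp_rw [Finset.sum_add_distrib]
    rw [Finset.sum_comm]
    simp only [Finset.sum_ite_eq', Finset.mem_univ, if_true]
    rw [← Finset.sum_add_distrib]
    refine Finset.sum_congr rfl fun k _ => ?_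
    rcases le_or_gt i k with h | h
    · simp [h, not_lt.mpr h]
    · simp [h, not_le.mpr h]
  rw [henergy, henergy, hrow, ← Finset.sum_add_distrib]
  refine Finset.sum_congr rfl fun p _ => ?_
  rw [← Finset.sum_add_distrib]
  refine Finset.sum_congr rfl fun q _ => ?_
  by_cases hp : p = i
  · subst hp
    by_cases hq : q = p
    · subst hq
      simp [hi]
    · simp [hi, hq]
  · by_cases hq : q = i
    · subst hq
      rw [hQ.apply q p]
      simp [hi, hp, lt_iff_le_and_ne]
    · simp [hp, hq]

theorem negRowSum_nonpos {n : ℕ} (Q : Matrix (Fin n) (Fin n) ℝ) (i : Fin n) :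
    negRowSum Q i ≤ 0 :=
  Finset.sum_nonpos fun k _ => by split_ifs with h <;> linarith

theorem IsBinary.update_zero {n : ℕ} {x : Fin n → ℝ} (hx : IsBinary x) (i : Fin n) :
    IsBinary (Function.update x i 0) := by
  intro p
  by_cases hp : p = i
  · simp [hp]
  · simpa [hp] using hx p

theorem IsBinary.ite_neg_le_mul {n : ℕ} {x : Fin n → ℝ} (hx : IsBinary x) (k : Fin n) (a : ℝ) :
    (if a < 0 then a else 0) ≤ x k * a := by
  rcases hx k with h | h <;> rw [h] <;> split_ifs <;> linarith

theorem IsBinary.negRowSum_le {n : ℕ} {x : Fin n → ℝ} (hx : IsBinary x)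
    (Q : Matrix (Fin n) (Fin n) ℝ) (i : Fin n) : negRowSum Q i ≤ ∑ k, x k * Q i k :=
  Finset.sum_le_sum fun k _ => hx.ite_neg_le_mul k (Q i k)

/-- A nonnegative coupling to an active variable improves the lower bound on the row sum. -/
theorem IsBinary.add_negRowSum_le {n : ℕ} {x : Fin n → ℝ} (hx : IsBinary x)
    {Q : Matrix (Fin n) (Fin n) ℝ} {i j : Fin n} (hj : x j = 1) (hpos : 0 ≤ Q i j) :
    Q i j + negRowSum Q i ≤ ∑ k, x k * Q i k := by
  rw [negRowSum, ← Finset.add_sum_erase _ _ (Finset.mem_univ j),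
    ← Finset.add_sum_erase Finset.univ (fun k => x k * Q i k) (Finset.mem_univ j)]
  simp only [hj, one_mul, if_neg hpos.not_gt, zero_add]
  gcongr with k
  exact hx.ite_neg_le_mul k (Q i k)

theorem conflict_criterion_correct {n : ℕ} (Q : Matrix (Fin n) (Fin n) ℝ)
    (hQ : Q.IsSymm) (i j : Fin n) (hij : i ≠ j)
    (hcrit : Q i j > -negRowSum Q i - negRowSum Q j) :
    ∀ x : Fin n → ℝ, IsBinary x → x i = 1 → x j = 1 →
      energy Q x > energy Q (Function.update x i 0) ∧
      energy Q x > energy Q (Function.update x j 0) ∧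
      energy Q x > energy Q (Function.update (Function.update x i 0) j 0) := by
  intro x hx hi hj
  have hZi := negRowSum_nonpos Q i
  have hZj := negRowSum_nonpos Q j
  have hpos : 0 ≤ Q i j := by linarith
  have hsymm : Q j i = Q i j := hQ.apply i j
  have hbi := hx.add_negRowSum_le hj hpos
  have hbj := hx.add_negRowSum_le hi (hsymm ▸ hpos)
  have hb := (hx.update_zero i).negRowSum_le Q j
  have hei := energy_eq_energy_update_add hQ hi
  have hej := energy_eq_energy_update_add hQ hj
  have heij := energy_eq_energy_update_add hQ (i := j) (x := Function.update x i 0)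
    (by simpa [hij.symm] using hj)
  refine ⟨?_, ?_, ?_⟩ <;> linarith
end
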